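/- arXiv:1412.0247 — 4 statements merged into one kernel-verified Lean document; each statement's English description precedes it below -/
import Mathlib

section
/- Fix a type X, reals β > 0 and λ > 0, and a map T : (X → ℝ) → (X → ℝ). Then the following are equivalent: (i) for all f₁, f₂ : X → ℝ and all x ∈ X, T(f₁)(x) + T(f₂)(x) = −β⁻¹·log( exp(−β·T(T(f₁)+f₂)(x)) + exp(−β·T(f₁+T(f₂))(x)) + exp(−β·(T(f₁+f₂)(x) + log λ)) ) (the min-plus Rota–Baxter identity of weight λ for the Shannon-deformed addition ⊕_{β,S}); (ii) for all f₁, f₂ : X → ℝ and all x ∈ X, exp(−β·T(f₁)(x))·exp(−β·T(f₂)(x)) = exp(−β·T(T(f₁)+f₂)(x)) + exp(−β·T(f₁+T(f₂))(x)) + λ^{−β}·exp(−β·T(f₁+f₂)(x)) (the ordinary Rota–Baxter identity of weight λ^{−β} for the conjugated operator 𝒯 defined by 𝒯(exp(−β·f)) = exp(−β·T(f))). -/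
open Real

/-- for `β > 0` and `λ > 0`, the min-plus (thermodynamic) Rota–Baxter
identity of weight `λ` for an operator `T` on functions `X → ℝ`, with respect to the
Shannon-deformed addition `⊕_{β,S}`, is equivalent to the ordinary Rota–Baxter
identity of weight `λ^{-β}` for the conjugated operator `𝒯(exp(-β f)) = exp(-β T f)`. -/
theorem thermo_rota_baxter_weight_pos_iff {X : Type*} (β l : ℝ) (hβ : 0 < β)
    (hl : 0 < l) (T : (X → ℝ) → (X → ℝ)) :
    (∀ f₁ f₂ : X → ℝ, ∀ x : X,
        T f₁ x + T f₂ x =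
          -β⁻¹ * Real.log
            (Real.exp (-β * T (T f₁ + f₂) x) + Real.exp (-β * T (f₁ + T f₂) x) +
              Real.exp (-β * (T (f₁ + f₂) x + Real.log l)))) ↔
    (∀ f₁ f₂ : X → ℝ, ∀ x : X,
        Real.exp (-β * T f₁ x) * Real.exp (-β * T f₂ x) =
          Real.exp (-β * T (T f₁ + f₂) x) + Real.exp (-β * T (f₁ + T f₂) x) +
            l ^ (-β) * Real.exp (-β * T (f₁ + f₂) x)) := by
  refine forall_congr' fun f₁ => forall_congr' fun f₂ => forall_congr' fun x => ?_
  have h3 : Real.exp (-β * (T (f₁ + f₂) x + Real.log l)) =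
      l ^ (-β) * Real.exp (-β * T (f₁ + f₂) x) := by
    rw [Real.rpow_def_of_pos hl, ← Real.exp_add]
    congr 1
    ring
  rw [h3, ← Real.exp_add]
  have hS : 0 < Real.exp (-β * T (T f₁ + f₂) x) + Real.exp (-β * T (f₁ + T f₂) x) +
      l ^ (-β) * Real.exp (-β * T (f₁ + f₂) x) := by positivity
  generalize Real.exp (-β * T (T f₁ + f₂) x) + Real.exp (-β * T (f₁ + T f₂) x) +
      l ^ (-β) * Real.exp (-β * T (f₁ + f₂) x) = S at hS ⊢
  constructor
  · intro h
    have h4 : -β * T f₁ x + -β * T f₂ x = Real.log S := by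
      rw [← mul_add, h]
      field_simp
    rw [h4, Real.exp_log hS]
  · intro h
    rw [← h, Real.log_exp]
    field_simp
    ring
end

section
/- Fix a type X, reals β > 0 and λ < 0, and a map T : (X → ℝ) → (X → ℝ). Then the following are equivalent: (i) for all f₁, f₂ : X → ℝ and all x ∈ X, −β⁻¹·log( exp(−β·(T(f₁)(x)+T(f₂)(x))) + exp(−β·(T(f₁+f₂)(x) + log(−λ))) ) = −β⁻¹·log( exp(−β·T(T(f₁)+f₂)(x)) + exp(−β·T(f₁+T(f₂))(x)) ) (the min-plus Rota–Baxter identity of weight λ for the Shannon-deformed addition ⊕_{β,S}); (ii) for all f₁, f₂ : X → ℝ and all x ∈ X, exp(−β·(T(f₁)(x)+T(f₂)(x))) + (−λ)^{−β}·exp(−β·T(f₁+f₂)(x)) = exp(−β·T(T(f₁)+f₂)(x)) + exp(−β·T(f₁+T(f₂))(x)) (the ordinary Rota–Baxter identity of weight −(−λ)^{−β} for the conjugated operator 𝒯 defined by 𝒯(exp(−β·f)) = exp(−β·T(f))). -/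
open Real

/-- for `β > 0` and `λ < 0`, the min-plus (thermodynamic) Rota–Baxter
identity of weight `λ` for an operator `T` on functions `X → ℝ`, with respect to the
Shannon-deformed addition `⊕_{β,S}`, is equivalent to the ordinary Rota–Baxter
identity of weight `-(-λ)^{-β}` for the conjugated operator `𝒯(exp(-β f)) = exp(-β T f)`. -/
theorem thermo_rota_baxter_weight_neg_iff {X : Type*} (β l : ℝ) (hβ : 0 < β)
    (hl : l < 0) (T : (X → ℝ) → (X → ℝ)) :
    (∀ f₁ f₂ : X → ℝ, ∀ x : X,
        -β⁻¹ * Real.log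
            (Real.exp (-β * (T f₁ x + T f₂ x)) +
              Real.exp (-β * (T (f₁ + f₂) x + Real.log (-l)))) =
          -β⁻¹ * Real.log
            (Real.exp (-β * T (T f₁ + f₂) x) + Real.exp (-β * T (f₁ + T f₂) x))) ↔
    (∀ f₁ f₂ : X → ℝ, ∀ x : X,
        Real.exp (-β * (T f₁ x + T f₂ x)) + (-l) ^ (-β) * Real.exp (-β * T (f₁ + f₂) x) =
          Real.exp (-β * T (T f₁ + f₂) x) + Real.exp (-β * T (f₁ + T f₂) x)) := by
  have key : ∀ t : ℝ, Real.exp (-β * (t + Real.log (-l))) = (-l) ^ (-β) * Real.exp (-β * t) := by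
    intro t
    rw [Real.rpow_def_of_pos (by linarith), ← Real.exp_add]
    congr 1
    ring
  have hne : -β⁻¹ ≠ 0 := neg_ne_zero.mpr (inv_ne_zero hβ.ne')
  refine forall_congr' fun f₁ => forall_congr' fun f₂ => forall_congr' fun x => ?_
  rw [← key]
  constructor
  · intro h
    exact Real.log_injOn_pos (Set.mem_Ioi.mpr (by positivity)) (Set.mem_Ioi.mpr (by positivity))
      (mul_left_cancel₀ hne h)
  · intro h
    rw [h]
end

section
/- Fix a real β > 0. On functions g : ℕ → ℝ ∪ {+∞}, define the partial-sum operator T by (T g)(0) = +∞ and, for n ≥ 1, (T g)(n) = −β⁻¹·log( Σ_{k=0}^{n−1} exp(−β·g(k)) ), with the conventions exp(−β·(+∞)) = 0 and −β⁻¹·log 0 = +∞. Then T satisfies the thermodynamic Rota–Baxter identity of weight +1: for all g₁, g₂ : ℕ → ℝ ∪ {+∞} and all n, (T g₁)(n) + (T g₂)(n) = −β⁻¹·log( exp(−β·T(T g₁ + g₂)(n)) + exp(−β·T(g₁ + T g₂)(n)) + exp(−β·T(g₁ + g₂)(n)) ), where sums of functions are pointwise with (+∞) + a = +∞. -/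
open Real

/-- `exp(-β · a)` for `a ∈ ℝ ∪ {+∞}`, with the convention `exp(-β · (+∞)) = 0`. -/
noncomputable def negExp (β : ℝ) : WithTop ℝ → ℝ :=
  WithTop.recTopCoe 0 fun a => Real.exp (-β * a)

/-- `-β⁻¹ · log r ∈ ℝ ∪ {+∞}`, with the convention `-β⁻¹ · log 0 = +∞`. -/
noncomputable def negLog (β : ℝ) (r : ℝ) : WithTop ℝ :=
  if r = 0 then ⊤ else ((-β⁻¹ * Real.log r : ℝ) : WithTop ℝ)

/-- The thermodynamic partial-sum operator: `(T g)(0) = +∞` and, for `n ≥ 1`,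
`(T g)(n) = -β⁻¹ log (Σ_{k=0}^{n-1} exp(-β g(k)))` (the empty sum at `n = 0`
gives `negLog β 0 = +∞`, as required). -/
noncomputable def parSum (β : ℝ) (g : ℕ → WithTop ℝ) : ℕ → WithTop ℝ :=
  fun n => negLog β (∑ k ∈ Finset.range n, negExp β (g k))

lemma negExp_nonneg (β : ℝ) (a : WithTop ℝ) : 0 ≤ negExp β a := by
  induction a using WithTop.recTopCoe with
  | top => exact le_refl (0 : ℝ)
  | coe a => exact (Real.exp_pos _).le

lemma negExp_add (β : ℝ) (a b : WithTop ℝ) : negExp β (a + b) = negExp β a * negExp β b := by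
  induction a using WithTop.recTopCoe with
  | top => rw [top_add]; exact (zero_mul _).symm
  | coe a =>
    induction b using WithTop.recTopCoe with
    | top => rw [add_top]; exact (mul_zero _).symm
    | coe b =>
      change Real.exp (-β * (a + b)) = Real.exp (-β * a) * Real.exp (-β * b)
      rw [← Real.exp_add]; ring_nf

lemma negExp_negLog (β : ℝ) (hβ : 0 < β) (r : ℝ) (hr : 0 ≤ r) : negExp β (negLog β r) = r := by
  unfold negLog
  split_ifs with h
  · exact h.symm
  · change Real.exp (-β * (-β⁻¹ * Real.log r)) = r
    have : -β * (-β⁻¹ * Real.log r) = Real.log r := by field_simp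
    rw [this, Real.exp_log (lt_of_le_of_ne hr (Ne.symm h))]

lemma negLog_mul (β r s : ℝ) : negLog β (r * s) = negLog β r + negLog β s := by
  unfold negLog
  by_cases hr : r = 0
  · simp [hr]
  by_cases hs : s = 0
  · simp [hs]
  rw [if_neg (mul_ne_zero hr hs), if_neg hr, if_neg hs, ← WithTop.coe_add,
    Real.log_mul hr hs, mul_add]

lemma negExp_parSum (β : ℝ) (hβ : 0 < β) (g : ℕ → WithTop ℝ) (n : ℕ) :
    negExp β (parSum β g n) = ∑ k ∈ Finset.range n, negExp β (g k) :=
  negExp_negLog β hβ _ (Finset.sum_nonneg fun _ _ => negExp_nonneg _ _)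

/-- the partial-sum operator satisfies the thermodynamic Rota–Baxter
identity of weight `+1`:
`T g₁ ⊙ T g₂ = T(T g₁ ⊙ g₂) ⊕_{β,S} T(g₁ ⊙ T g₂) ⊕_{β,S} T(g₁ ⊙ g₂)`,
where `⊙` is pointwise addition on `ℝ ∪ {+∞}` (with `(+∞) + a = +∞`). -/
theorem parSum_rota_baxter_weight_one (β : ℝ) (hβ : 0 < β)
    (g₁ g₂ : ℕ → WithTop ℝ) (n : ℕ) :
    parSum β g₁ n + parSum β g₂ n =
      negLog β
        (negExp β (parSum β (parSum β g₁ + g₂) n) +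
          negExp β (parSum β (g₁ + parSum β g₂) n) +
          negExp β (parSum β (g₁ + g₂) n)) := by
  rw [negExp_parSum β hβ, negExp_parSum β hβ, negExp_parSum β hβ]
  simp only [Pi.add_apply, negExp_add, negExp_parSum β hβ]
  simp only [parSum]
  rw [← negLog_mul]
  congr 1
  induction n with
  | zero => simp
  | succ n ih =>
    simp only [Finset.sum_range_succ]
    linear_combination ih
end

section
/- Let G be a simple graph on a vertex type V and let W be a real-valued function on finite subsets of V that is a nearest neighbor potential (for every finite A ⊆ V and v ∉ A, W(A ∪ {v}) − W(A) = W((A ∩ N(v)) ∪ {v}) − W(A ∩ N(v))) and satisfies W(∅) = 0. Then W is additive on disjoint unions with no connecting edges: for all finite disjoint subsets A, B ⊆ V such that no vertex of A is adjacent in G to any vertex of B, W(A ∪ B) = W(A) + W(B). -/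
/-- a nearest neighbor potential `W` on the finite subsets of the
vertices of a simple graph `G`, normalized by `W(∅) = 0`, is additive on disjoint
unions with no connecting edges: `W(A ∪ B) = W(A) + W(B)` whenever `A` and `B` are
disjoint and no vertex of `A` is adjacent to any vertex of `B`. -/
theorem nearest_neighbor_potential_additive
    {V : Type*} [DecidableEq V] (G : SimpleGraph V) [DecidableRel G.Adj]
    (W : Finset V → ℝ)
    (hW : ∀ (A : Finset V) (v : V), v ∉ A →
      W (insert v A) - W A =
        W (insert v (A.filter fun u => G.Adj v u)) - W (A.filter fun u => G.Adj v u))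
    (h0 : W ∅ = 0) :
    ∀ A B : Finset V, Disjoint A B → (∀ a ∈ A, ∀ b ∈ B, ¬ G.Adj a b) →
      W (A ∪ B) = W A + W B := by
  intro A B
  induction A using Finset.induction_on with
  | empty => intro _ _; simp [h0]
  | insert v A hv ih =>
    intro hd hadj
    rw [Finset.disjoint_insert_left] at hd
    have ih' := ih hd.2 (fun a ha b hb => hadj a (Finset.mem_insert_of_mem ha) b hb)
    have hvAB : v ∉ A ∪ B := by
      rw [Finset.mem_union]
      rintro (h | h)
      · exact hv h
      · exact hd.1 h
    have hB : B.filter (fun u => G.Adj v u) = ∅ :=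
      Finset.filter_eq_empty_iff.mpr
        (fun b hb => hadj v (Finset.mem_insert_self v A) b hb)
    have h1 := hW (A ∪ B) v hvAB
    have h2 := hW A v hv
    rw [Finset.filter_union, hB, Finset.union_empty] at h1
    rw [Finset.insert_union]
    linarith
end
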